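/- Suppose K = nα for a real α with 0 < α < p, and let β satisfy 0 < β < 1 and β < (p−α)/p. Set δ = (1/2)(p − α/(1−β)) and T = ⌈(log((p − α − pβ)/2) − log(p/2 − α + α/(2(1−β)))) / log(1 − p/2 − α/(2(1−β)))⌉ + 1. Then for every integer t ≥ T, the error chain started at X_0 = 0 satisfies P[X_t > nβ] ≥ (1 − exp(−2n(1−β)δ²))^T. In particular, T depends only on p, α and β and not on n, so the number of erroneous qubits exceeds nβ within constant time with probability tending to 1 as n → ∞. -/

import Mathlib

/-- The probability mass function of a `Binomial(m, p)` random variable at `k`. -/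
noncomputable def binomPMF (m : ℕ) (p : ℝ) (k : ℕ) : ℝ :=
  (m.choose k : ℝ) * p ^ k * (1 - p) ^ (m - k)

/-- One-step transition probability of the error Markov chain on `{0, ..., n}`:
from state `x`, draw `Y ~ Binomial(n − x, p)` and move to `x + Y − min (x + Y) K`. -/
noncomputable def stepProb (n K : ℕ) (p : ℝ) (x y : ℕ) : ℝ :=
  ∑ yv ∈ Finset.range (n - x + 1),
    if x + yv - min (x + yv) K = y then binomPMF (n - x) p yv else 0

/-- `m`-step transition probability of the error Markov chain. -/
noncomputable def iterProb (n K : ℕ) (p : ℝ) : ℕ → ℕ → ℕ → ℝ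
  | 0 => fun x y => if x = y then 1 else 0
  | (m + 1) => fun x y =>
      ∑ z ∈ Finset.range (n + 1), stepProb n K p x z * iterProb n K p m z y

/-- Expectation of `g` under `Binomial(N, p)`. -/
noncomputable def binE (p : ℝ) (N : ℕ) (g : ℕ → ℝ) : ℝ :=
  ∑ k ∈ Finset.range (N + 1), binomPMF N p k * g k

lemma binomPMF_nonneg' {p : ℝ} (hp0 : 0 ≤ p) (hp1 : p ≤ 1) (N k : ℕ) :
    0 ≤ binomPMF N p k := by
  have : 0 ≤ 1 - p := by linarith
  unfold binomPMF; positivity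

lemma binE_mono {p : ℝ} (hp0 : 0 ≤ p) (hp1 : p ≤ 1) (N : ℕ) {g h : ℕ → ℝ}
    (hgh : ∀ k, g k ≤ h k) : binE p N g ≤ binE p N h :=
  Finset.sum_le_sum fun k _ =>
    mul_le_mul_of_nonneg_left (hgh k) (binomPMF_nonneg' hp0 hp1 N k)

lemma binE_smul (p : ℝ) (N : ℕ) (c : ℝ) (g : ℕ → ℝ) :
    binE p N (fun k => c * g k) = c * binE p N g := by
  unfold binE; rw [Finset.mul_sum]; exact Finset.sum_congr rfl fun k _ => by ring

lemma binE_sub (p : ℝ) (N : ℕ) (f g : ℕ → ℝ) :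
    binE p N (fun k => f k - g k) = binE p N f - binE p N g := by
  unfold binE; rw [← Finset.sum_sub_distrib]; exact Finset.sum_congr rfl fun k _ => by ring

lemma binE_geom (p : ℝ) (N : ℕ) (r : ℝ) :
    binE p N (fun k => r ^ k) = (1 - p + p * r) ^ N := by
  unfold binE binomPMF
  rw [add_comm (1 - p), add_pow]
  exact Finset.sum_congr rfl fun k _ => by rw [mul_pow]; ring

lemma binE_one (p : ℝ) (N : ℕ) : binE p N (fun _ => 1) = 1 := by
  have := binE_geom p N 1
  simpa using this

lemma binE_const (p : ℝ) (N : ℕ) (c : ℝ) : binE p N (fun _ => c) = c := by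
  have := binE_smul p N c (fun _ => 1)
  rw [binE_one] at this; simpa using this

lemma binE_succ (p : ℝ) (N : ℕ) (g : ℕ → ℝ) :
    binE p (N + 1) g = (1 - p) * binE p N g + p * binE p N (fun k => g (k + 1)) := by
  have e1 : binE p N g = (1 - p) ^ N * g 0 +
      ∑ k ∈ Finset.range (N + 1), (N.choose (k+1) : ℝ) * p ^ (k+1) * (1 - p) ^ (N - (k+1))
        * g (k + 1) := by
    unfold binE
    rw [Finset.sum_range_succ', Finset.sum_range_succ (n := N)]
    simp [binomPMF, add_comm]
  unfold binE at *
  rw [Finset.sum_range_succ', e1, mul_add, Finset.mul_sum, Finset.mul_sum, add_assoc,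
    ← Finset.sum_add_distrib, add_comm]
  congr 1
  · simp [binomPMF]; ring
  · refine Finset.sum_congr rfl fun k hk => ?_
    have hk' : k ≤ N := by simpa [Nat.lt_succ_iff] using hk
    unfold binomPMF
    rw [Nat.choose_succ_succ, Nat.add_sub_add_right]
    rcases hk'.lt_or_eq with h | h
    · obtain ⟨d, rfl⟩ := Nat.exists_eq_add_of_lt h
      rw [show k + d + 1 - k = d + 1 by omega, show k + d + 1 - (k + 1) = d by omega]
      push_cast; ring
    · subst h; simp; ring

/-- One step operator of the chain. -/
noncomputable def Qop (n K : ℕ) (p : ℝ) (h : ℕ → ℝ) (x : ℕ) : ℝ :=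
  binE p (n - x) (fun k => h (x + k - K))

lemma Qop_mono {p : ℝ} (hp0 : 0 ≤ p) (hp1 : p ≤ 1) (n K : ℕ) {g h : ℕ → ℝ}
    (hgh : ∀ k, g k ≤ h k) (x : ℕ) : Qop n K p g x ≤ Qop n K p h x :=
  binE_mono hp0 hp1 _ fun _ => hgh _

lemma Qop_monotone {p : ℝ} (hp0 : 0 ≤ p) (hp1 : p ≤ 1) (n K : ℕ) {h : ℕ → ℝ}
    (hh : Monotone h) : Monotone (Qop n K p h) := by
  refine monotone_nat_of_le_succ fun x => ?_
  unfold Qop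
  rcases lt_or_ge x n with hx | hx
  · obtain ⟨N, hN⟩ := Nat.exists_eq_add_of_lt hx
    rw [show n - x = N + 1 by omega, show n - (x + 1) = N by omega, binE_succ]
    have h1 : binE p N (fun k => h (x + k - K)) ≤ binE p N (fun k => h (x + 1 + k - K)) :=
      binE_mono hp0 hp1 _ fun k => hh (by omega)
    have h2 : binE p N (fun k => h (x + (k + 1) - K)) = binE p N (fun k => h (x + 1 + k - K)) := by
      congr 1; funext k; congr 1; omega
    rw [h2]
    nlinarith
  · rw [show n - x = 0 by omega, show n - (x + 1) = 0 by omega]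
    exact binE_mono hp0 hp1 _ fun k => hh (by omega)

lemma Qiter_mono {p : ℝ} (hp0 : 0 ≤ p) (hp1 : p ≤ 1) (n K t : ℕ) : ∀ {g h : ℕ → ℝ},
    (∀ k, g k ≤ h k) → ∀ x, (Qop n K p)^[t] g x ≤ (Qop n K p)^[t] h x := by
  induction t with
  | zero => intro g h hgh x; simpa using hgh x
  | succ t ih =>
    intro g h hgh x
    rw [Function.iterate_succ_apply, Function.iterate_succ_apply]
    exact ih (Qop_mono hp0 hp1 n K hgh) x

lemma Qiter_monotone {p : ℝ} (hp0 : 0 ≤ p) (hp1 : p ≤ 1) (n K t : ℕ) {h : ℕ → ℝ}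
    (hh : Monotone h) : Monotone ((Qop n K p)^[t] h) := by
  induction t with
  | zero => simpa using hh
  | succ t ih => rw [Function.iterate_succ_apply']; exact Qop_monotone hp0 hp1 n K ih

lemma Qiter_smul (n K t : ℕ) (p c : ℝ) : ∀ (h : ℕ → ℝ),
    (Qop n K p)^[t] (fun x => c * h x) = fun x => c * (Qop n K p)^[t] h x := by
  induction t with
  | zero => intro h; rfl
  | succ t ih =>
    intro h
    rw [Function.iterate_succ_apply, Function.iterate_succ_apply, ← ih]
    congr 1
    funext x
    exact binE_smul p _ c _

lemma Qiter_time {p : ℝ} (hp0 : 0 ≤ p) (hp1 : p ≤ 1) (n K : ℕ) {h : ℕ → ℝ}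
    (hh : Monotone h) : Monotone (fun t => (Qop n K p)^[t] h 0) := by
  refine monotone_nat_of_le_succ fun t => ?_
  rw [Function.iterate_succ_apply']
  have h1 := binE_const p (n - 0) ((Qop n K p)^[t] h 0)
  rw [← h1]
  exact binE_mono hp0 hp1 _ fun k => Qiter_monotone hp0 hp1 n K t hh (Nat.zero_le _)

lemma stepProb_sum (n K : ℕ) (p : ℝ) (h : ℕ → ℝ) (x : ℕ) (hx : x ≤ n) :
    ∑ z ∈ Finset.range (n + 1), stepProb n K p x z * h z = Qop n K p h x := by
  unfold stepProb Qop binE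
  simp_rw [Finset.sum_mul]
  rw [Finset.sum_comm]
  refine Finset.sum_congr rfl fun k hk => ?_
  have hk' : k < n - x + 1 := by simpa using hk
  have e : x + k - min (x + k) K = x + k - K := by omega
  rw [e]
  simp_rw [ite_mul, zero_mul]
  rw [Finset.sum_ite_eq, if_pos (by simp; omega)]

lemma iterProb_sum (n K : ℕ) (p : ℝ) (h : ℕ → ℝ) (t : ℕ) : ∀ x ≤ n,
    ∑ y ∈ Finset.range (n + 1), iterProb n K p t x y * h y = (Qop n K p)^[t] h x := by
  induction t with
  | zero =>
    intro x hx
    simp only [iterProb, ite_mul, zero_mul, one_mul, Function.iterate_zero, id]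
    rw [Finset.sum_ite_eq, if_pos (by simp; omega)]
  | succ t ih =>
    intro x hx
    rw [Function.iterate_succ_apply', ← stepProb_sum n K p _ x hx]
    simp only [iterProb, Finset.sum_mul]
    rw [Finset.sum_comm]
    refine Finset.sum_congr rfl fun z hz => ?_
    rw [← ih z (by simpa [Nat.lt_succ_iff] using hz), Finset.mul_sum]
    exact Finset.sum_congr rfl fun y _ => by ring

open MeasureTheory ProbabilityTheory in
lemma hoeffding_bern {p : ℝ} (hp0 : 0 ≤ p) (hp1 : p ≤ 1) (s : ℝ) :
    1 - p + p * Real.exp s ≤ Real.exp (s * p + s ^ 2 / 8) := by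
  let μ : Measure ℝ := ENNReal.ofReal (1 - p) • Measure.dirac 0 + ENNReal.ofReal p • Measure.dirac 1
  have hμ : IsProbabilityMeasure μ := by
    constructor
    simp only [μ, Measure.add_apply, Measure.smul_apply, measure_univ, smul_eq_mul, mul_one]
    rw [← ENNReal.ofReal_add (by linarith) hp0]; simp
  have hint : ∀ f : ℝ → ℝ, ∫ x, f x ∂μ = (1 - p) * f 0 + p * f 1 := by
    intro f
    rw [integral_add_measure, integral_smul_measure, integral_smul_measure, integral_dirac,
      integral_dirac, ENNReal.toReal_ofReal (by linarith), ENNReal.toReal_ofReal hp0]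
    · simp
    · exact (integrable_dirac (by simp)).smul_measure ENNReal.ofReal_ne_top
    · exact (integrable_dirac (by simp)).smul_measure ENNReal.ofReal_ne_top
  have hae : ∀ᵐ x ∂μ, (id x : ℝ) ∈ Set.Icc (0 : ℝ) 1 := by
    simp only [μ, ae_add_measure_iff]
    constructor <;> refine Measure.ae_smul_measure ?_ _ <;>
      · exact (ae_dirac_iff (measurableSet_Icc (a := (0 : ℝ)) (b := 1))).mpr (by simp)
  have h := (hasSubgaussianMGF_of_mem_Icc (μ := μ) (X := id) aemeasurable_id hae).mgf_le s
  unfold mgf at h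
  rw [hint, hint] at h
  simp at h
  have e : Real.exp (s * p + s ^ 2 / 8) = Real.exp (s * p) * Real.exp (s ^ 2 / 8) := Real.exp_add _ _
  rw [e]
  have h2 := mul_le_mul_of_nonneg_left h (Real.exp_pos (s * p)).le
  have e1 : Real.exp (s * p) * Real.exp (-(s * p)) = 1 := by rw [← Real.exp_add]; simp
  have e2 : Real.exp (s * p) * Real.exp (s * (1 - p)) = Real.exp s := by
    rw [← Real.exp_add]; ring_nf
  calc 1 - p + p * Real.exp s
      = (1 - p) * (Real.exp (s * p) * Real.exp (-(s * p))) +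
        p * (Real.exp (s * p) * Real.exp (s * (1 - p))) := by rw [e1, e2]; ring
    _ ≤ _ := by
      refine le_trans (le_of_eq (by ring)) (h2.trans (le_of_eq ?_))
      congr 2
      ring

lemma binE_tail {p : ℝ} (hp0 : 0 ≤ p) (hp1 : p ≤ 1) (N : ℕ) (δ : ℝ) (hδ : 0 ≤ δ) :
    1 - Real.exp (-2 * N * δ ^ 2) ≤
      binE p N (fun k => if (N : ℝ) * (p - δ) ≤ k then 1 else 0) := by
  have h1 : binE p N (fun k => 1 - Real.exp (4 * δ * (N * (p - δ))) * (Real.exp (-4 * δ)) ^ k) ≤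
      binE p N (fun k => if (N : ℝ) * (p - δ) ≤ k then 1 else 0) := by
    refine binE_mono hp0 hp1 N fun k => ?_
    rw [← Real.exp_nat_mul, ← Real.exp_add]
    split_ifs with hk
    · linarith [Real.exp_pos (4 * δ * (N * (p - δ)) + k * (-4 * δ))]
    · have : 0 ≤ 4 * δ * (N * (p - δ)) + k * (-4 * δ) := by
        push Not at hk
        nlinarith
      linarith [Real.one_le_exp this]
  refine le_trans ?_ h1
  rw [binE_sub p N (fun _ => 1), binE_one, binE_smul, binE_geom]
  have h2 : (1 - p + p * Real.exp (-4 * δ)) ^ N ≤ Real.exp (-4 * δ * p + (-4 * δ) ^ 2 / 8) ^ N :=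
    pow_le_pow_left₀ (by have := Real.exp_pos (-4 * δ); nlinarith [mul_nonneg hp0 this.le])
      (hoeffding_bern hp0 hp1 _) N
  have h3 := mul_le_mul_of_nonneg_left h2 (Real.exp_pos (4 * δ * (N * (p - δ)))).le
  rw [← Real.exp_nat_mul, ← Real.exp_add] at h3
  have e : 4 * δ * (N * (p - δ)) + N * (-4 * δ * p + (-4 * δ) ^ 2 / 8) = -2 * N * δ ^ 2 := by ring
  rw [e] at h3
  linarith

/-- Indicator of being at least `a`. -/
noncomputable def indGe (a x : ℕ) : ℝ := if a ≤ x then 1 else 0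

lemma indGe_monotone (a : ℕ) : Monotone (indGe a) := by
  intro x y hxy
  unfold indGe
  split_ifs <;> first | omega | norm_num

lemma whp_core (n K : ℕ) (p α β δ m e : ℝ) (hp0 : 0 ≤ p) (hp1 : p ≤ 1)
    (hK : (K : ℝ) = n * α) (hδ : 0 ≤ δ) (hm : m = p - δ) (hm1 : m ≤ 1)
    (hβ1 : β < 1) (hβ0 : 0 ≤ β)
    (he : e = Real.exp (-2 * n * (1 - β) * δ ^ 2)) (u : ℕ → ℝ) (hu0 : u 0 = 0)
    (hu : ∀ t, u (t + 1) = m - α + (1 - m) * u t) (t : ℕ) :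
    (∃ s ≤ t, ∃ a : ℕ, (n : ℝ) * β < a ∧ (1 - e) ^ s ≤ (Qop n K p)^[s] (indGe a) 0) ∨
    (∃ a : ℕ, (a : ℝ) ≤ n * β ∧ n * u t ≤ a ∧ (1 - e) ^ t ≤ (Qop n K p)^[t] (indGe a) 0) := by
  have hnn : (0 : ℝ) ≤ n := Nat.cast_nonneg n
  have he1 : 0 ≤ 1 - e := by
    have : Real.exp (-2 * n * (1 - β) * δ ^ 2) ≤ 1 := by
      apply Real.exp_le_one_iff.mpr
      have : 0 ≤ n * (1 - β) * δ ^ 2 := by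
        have : 0 ≤ 1 - β := by linarith
        positivity
      nlinarith
    rw [he]; linarith
  induction t with
  | zero =>
    right
    exact ⟨0, by simpa using by positivity, by simp [hu0], by simp [indGe]⟩
  | succ t ih =>
    rcases ih with ⟨s, hs, h⟩ | ⟨a, ha, hua, hP⟩
    · exact Or.inl ⟨s, by omega, h⟩
    · have han : a ≤ n := by
        have : (a : ℝ) ≤ n := by nlinarith
        exact_mod_cast this
      have hN : ((n - a : ℕ) : ℝ) = n - a := Nat.cast_sub han
      set b := ⌈(a : ℝ) + (n - a) * m - n * α⌉₊ with hb
      have hbge : (a : ℝ) + (n - a) * m - n * α ≤ b := Nat.le_ceil _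
      have key : 1 - e ≤ Qop n K p (indGe b) a := by
        have h1 := binE_tail hp0 hp1 (n - a) δ hδ
        have h2 : 1 - e ≤ 1 - Real.exp (-2 * (n - a : ℕ) * δ ^ 2) := by
          rw [he]
          have : Real.exp (-2 * (n - a : ℕ) * δ ^ 2) ≤ Real.exp (-2 * n * (1 - β) * δ ^ 2) := by
            apply Real.exp_le_exp.mpr
            rw [hN]
            have : 0 ≤ (n * β - a) * δ ^ 2 := mul_nonneg (by linarith) (sq_nonneg δ)
            nlinarith
          linarith
        refine h2.trans (h1.trans (binE_mono hp0 hp1 _ fun k => ?_))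
        unfold indGe
        split_ifs with h3 h4
        · exact le_rfl
        · exfalso
          apply h4
          apply Nat.ceil_le.mpr
          rw [hN, ← hm] at h3
          have h5 : ((a + k : ℕ) : ℝ) ≤ ((a + k - K : ℕ) : ℝ) + (K : ℝ) := by
            exact_mod_cast (by omega : a + k ≤ a + k - K + K)
          push_cast at h5
          linarith
        · norm_num
        · exact le_rfl
      have hP' : (1 - e) ^ (t + 1) ≤ (Qop n K p)^[t + 1] (indGe b) 0 := by
        rw [Function.iterate_succ_apply]
        have h6 : ∀ x, (1 - e) * indGe a x ≤ Qop n K p (indGe b) x := by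
          intro x
          by_cases hx : a ≤ x
          · have := Qop_monotone hp0 hp1 n K (indGe_monotone b) hx
            simp only [indGe, hx, if_true, mul_one]
            exact key.trans this
          · simp only [indGe, hx, if_false, mul_zero]
            have h7 := binE_const p (n - x) 0
            rw [← h7]
            exact binE_mono hp0 hp1 _ fun k => by unfold indGe; split_ifs <;> norm_num
        have h8 := Qiter_mono hp0 hp1 n K t h6 0
        rw [Qiter_smul] at h8
        refine le_trans ?_ h8
        rw [pow_succ, mul_comm]
        exact mul_le_mul_of_nonneg_left hP he1
      by_cases hbb : (n : ℝ) * β < b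
      · exact Or.inl ⟨t + 1, le_rfl, b, hbb, hP'⟩
      · refine Or.inr ⟨b, not_lt.mp hbb, ?_, hP'⟩
        refine le_trans ?_ hbge
        rw [hu]
        have : (1 - m) * (n * u t) ≤ (1 - m) * a := mul_le_mul_of_nonneg_left hua (by linarith)
        nlinarith

/-- With `K = nα`, `0 < α < p`, `0 < β < 1` and `β < (p−α)/p`, set
`δ = (1/2)(p − α/(1−β))` and
`T = ⌈(log((p − α − pβ)/2) − log(p/2 − α + α/(2(1−β)))) / log(1 − p/2 − α/(2(1−β)))⌉ + 1`.
Then for every `t ≥ T`, the error chain started at `X₀ = 0` satisfies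
`P[X_t > nβ] ≥ (1 − exp(−2n(1−β)δ²))^T`. `T` depends only on `p`, `α`, `β` and not on `n`,
so the number of erroneous qubits exceeds `nβ` within constant time with probability
tending to `1` as `n → ∞`. -/
theorem hitting_time_whp (n K : ℕ) (hn : 0 < n) (p α β : ℝ)
    (hp0 : 0 < p) (hp1 : p < 1) (hKn : K ≤ n)
    (hK : (K : ℝ) = (n : ℝ) * α) (hα0 : 0 < α) (hαp : α < p)
    (hβ0 : 0 < β) (hβ1 : β < 1) (hβ : β < (p - α) / p) :
    ∀ t : ℕ,
      (⌈(Real.log ((p - α - p * β) / 2) - Real.log (p / 2 - α + α / (2 * (1 - β)))) /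
          Real.log (1 - p / 2 - α / (2 * (1 - β)))⌉ + 1 : ℤ) ≤ (t : ℤ) →
      (1 - Real.exp (-2 * n * (1 - β) * ((1 / 2) * (p - α / (1 - β))) ^ 2)) ^
          (⌈(Real.log ((p - α - p * β) / 2) - Real.log (p / 2 - α + α / (2 * (1 - β)))) /
              Real.log (1 - p / 2 - α / (2 * (1 - β)))⌉ + 1 : ℤ) ≤
        ∑ y ∈ Finset.range (n + 1),
          if (n : ℝ) * β < (y : ℝ) then iterProb n K p t 0 y else 0 := by
  intro t ht
  have hβ1' : 0 < 1 - β := by linarith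
  have hαb : α < p * (1 - β) := by
    rw [lt_div_iff₀ hp0] at hβ; nlinarith
  set q := α / (1 - β) with hq
  have hqe : q * (1 - β) = α := by rw [hq]; field_simp
  have hqp : q < p := by rw [hq, div_lt_iff₀ hβ1']; exact hαb
  have hq0 : 0 < q := by positivity
  have hq2 : α / (2 * (1 - β)) = q / 2 := by rw [hq]; field_simp
  rw [hq2] at ht ⊢
  set m := (p + q) / 2 with hm
  have hmα : 0 < m - α := by nlinarith
  have e1 : p / 2 - α + q / 2 = m - α := by rw [hm]; ring
  have e2 : 1 - p / 2 - q / 2 = 1 - m := by rw [hm]; ring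
  have e3 : (p - α - p * β) / 2 = m - α - m * β := by rw [hm]; linear_combination (-1/2) * hqe
  have hpos : 0 < m - α - m * β := by rw [← e3]; nlinarith
  rw [e1, e2, e3] at ht ⊢
  have hm0 : 0 < m := by rw [hm]; linarith
  have hm1 : m < 1 := by rw [hm]; linarith
  set L := (Real.log (m - α - m * β) - Real.log (m - α)) / Real.log (1 - m) with hL
  have hlog : Real.log (1 - m) < 0 := Real.log_neg (by linarith) (by linarith)
  have hLpos : 0 < L := by
    apply div_pos_of_neg_of_neg _ hlog
    have := Real.log_lt_log hpos (show m - α - m * β < m - α by nlinarith)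
    linarith
  have hceil : 0 < ⌈L⌉ := Int.ceil_pos.mpr hLpos
  obtain ⟨T, hT⟩ := Int.eq_ofNat_of_zero_le (show 0 ≤ ⌈L⌉ + 1 by omega)
  rw [hT] at ht ⊢
  have htT : T ≤ t := by exact_mod_cast ht
  rw [zpow_natCast]
  have hLT : L < T := by
    have h1 := Int.le_ceil L
    have h2 : ((⌈L⌉ + 1 : ℤ) : ℝ) = T := by rw [hT]; simp
    push_cast at h2
    linarith
  set δ := 1 / 2 * (p - q) with hδ
  have hδ0 : 0 < δ := by rw [hδ]; linarith
  set e := Real.exp (-2 * n * (1 - β) * δ ^ 2) with he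
  have he0 : 0 < e := Real.exp_pos _
  have he1 : e ≤ 1 := by
    apply Real.exp_le_one_iff.mpr
    have : 0 ≤ n * (1 - β) * δ ^ 2 := by positivity
    nlinarith
  let u : ℕ → ℝ := fun t => (m - α) / m * (1 - (1 - m) ^ t)
  have huT : β < u T := by
    have h1 : (1 - m) ^ T < (m - α - m * β) / (m - α) := by
      rw [← Real.log_lt_log_iff (pow_pos (by linarith) _) (by positivity), Real.log_pow,
        Real.log_div hpos.ne' hmα.ne']
      rw [hL, div_lt_iff_of_neg hlog] at hLT
      exact hLT
    rw [lt_div_iff₀ hmα] at h1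
    simp only [u]
    rw [div_mul_eq_mul_div, lt_div_iff₀ hm0]
    nlinarith
  have core := whp_core n K p α β δ m e hp0.le hp1.le hK hδ0.le (by rw [hm, hδ]; ring) hm1.le
    hβ1 hβ0.le he u (by simp [u]) (by intro t; simp only [u]; field_simp; ring) T
  have hnpos : (0 : ℝ) < n := by exact_mod_cast hn
  rcases core with ⟨s, hs, a, ha, hP⟩ | ⟨a, ha, hua, -⟩
  · have hsum : ∑ y ∈ Finset.range (n + 1),
          (if (n : ℝ) * β < (y : ℝ) then iterProb n K p t 0 y else 0) =
        (Qop n K p)^[t] (fun y : ℕ => if (n : ℝ) * β < (y : ℝ) then 1 else 0) 0 := by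
      rw [← iterProb_sum n K p _ t 0 (Nat.zero_le _)]
      exact Finset.sum_congr rfl fun y _ => by simp
    rw [hsum]
    calc (1 - e) ^ T ≤ (1 - e) ^ s := pow_le_pow_of_le_one (by linarith) (by linarith) hs
      _ ≤ (Qop n K p)^[s] (indGe a) 0 := hP
      _ ≤ (Qop n K p)^[t] (indGe a) 0 :=
        Qiter_time hp0.le hp1.le n K (indGe_monotone a) (hs.trans htT)
      _ ≤ _ := by
        refine Qiter_mono hp0.le hp1.le n K t (fun x => ?_) 0
        unfold indGe
        split_ifs with h1 h2 h2
        · exact le_rfl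
        · exfalso
          have : (a : ℝ) ≤ x := by exact_mod_cast h1
          linarith
        · norm_num
        · exact le_rfl
  · exfalso
    have := mul_lt_mul_of_pos_left huT hnpos
    linarith
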